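/- arXiv:alg-geom/9703001 — 2 statements merged into one kernel-verified Lean document; each statement's English description precedes it below -/
import Mathlib

section
/- Let ζ, u ∈ S_∞ and let k be a positive integer with u ≤_k ζ∘u. Then the map η ↦ η∘u is an order isomorphism from [e,ζ]_≼ := {η : η ≼ ζ} onto [u, ζ∘u]_k := {v : u ≤_k v ≤_k ζ∘u}: it is a bijection between these sets, and for all η, η' ≼ ζ one has η ≼ η' if and only if η∘u ≤_k η'∘u. -/
/-- `S_∞`: a permutation of the positive integers lies in `S_∞` iff it
fixes all but finitely many integers. -/
def finSupp (w : Equiv.Perm ℕ+) : Prop := {i : ℕ+ | w i ≠ i}.Finite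

/-- The length `ℓ(w) = #{(i,j) : i < j and w(i) > w(j)}`. -/
noncomputable def len (w : Equiv.Perm ℕ+) : ℕ :=
  {p : ℕ+ × ℕ+ | p.1 < p.2 ∧ w p.2 < w p.1}.ncard

/-- Cover relation of the `k`-Bruhat order: `w = u∘(a,b)` with `a ≤ k < b`
and `ℓ(w) = ℓ(u) + 1`. -/
def kBruhatCover (k : ℕ) (u w : Equiv.Perm ℕ+) : Prop :=
  ∃ a b : ℕ+, (a : ℕ) ≤ k ∧ k < (b : ℕ) ∧ w = u * Equiv.swap a b ∧ len w = len u + 1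

/-- The `k`-Bruhat order `≤_k`: reflexive–transitive closure of the cover relation. -/
def kBruhatLE (k : ℕ) : Equiv.Perm ℕ+ → Equiv.Perm ℕ+ → Prop :=
  Relation.ReflTransGen (kBruhatCover k)

/-- The relation `≼` on `S_∞`: `η ≼ ζ` iff there exist a positive integer `k`
and `u ∈ S_∞` with `u ≤_k η∘u ≤_k ζ∘u`. -/
def preceq (η ζ : Equiv.Perm ℕ+) : Prop :=
  ∃ k : ℕ, 0 < k ∧ ∃ u : Equiv.Perm ℕ+, finSupp u ∧
    kBruhatLE k u (η * u) ∧ kBruhatLE k (η * u) (ζ * u)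

namespace KBruhat

/-- The set of inversions of `w`, whose cardinality is `len w`. -/
def inversions (w : Equiv.Perm ℕ+) : Set (ℕ+ × ℕ+) :=
  {p | p.1 < p.2 ∧ w p.2 < w p.1}

theorem finite_inversions {w : Equiv.Perm ℕ+} (hw : finSupp w) : (inversions w).Finite := by
  obtain ⟨N, hN⟩ := hw.bddAbove
  refine ((Set.finite_Iic N).prod (Set.finite_Iic N)).subset ?_
  rintro ⟨i, j⟩ ⟨hij, hw'⟩
  have hfix : ∀ m, N < m → w m = m := fun m hm => by
    by_contra hne
    exact absurd (hN hne) (not_le.2 hm)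
  have hj : j ≤ N := by
    by_contra! hj
    have hwj := hfix j hj
    simp only at hij hw'
    rw [hwj] at hw'
    have hwi := w.injective (hfix (w i) (hj.trans hw'))
    exact absurd (hij.trans hw') (by rw [hwi]; exact lt_irrefl i)
  exact ⟨hij.le.trans hj, hj⟩

theorem finSupp_mul_swap {u : Equiv.Perm ℕ+} (hu : finSupp u) (a b : ℕ+) :
    finSupp (u * Equiv.swap a b) := by
  refine (hu.union (Set.toFinite {a, b})).subset fun i hi => ?_
  by_contra hne
  simp only [Set.mem_union, Set.mem_ofPred_eq, Set.mem_insert_iff, Set.mem_singleton_iff,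
    not_or, not_not] at hne
  apply hi
  rw [Equiv.Perm.mul_apply, Equiv.swap_apply_of_ne_of_ne hne.2.1 hne.2.2, hne.1]

theorem finSupp_of_kBruhatLE {k : ℕ} {u w : Equiv.Perm ℕ+} (hu : finSupp u)
    (h : kBruhatLE k u w) : finSupp w := by
  induction h with
  | refl => exact hu
  | tail _ hc ih =>
    obtain ⟨a, b, -, -, rfl, -⟩ := hc
    exact finSupp_mul_swap ih a b

/-- Apply `t` to both entries of a pair, unless this reverses their order. -/
def pairMap (t : Equiv.Perm ℕ+) (p : ℕ+ × ℕ+) : ℕ+ × ℕ+ :=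
  if t p.1 < t p.2 then (t p.1, t p.2) else p

theorem pairMap_swap_pairMap_swap (a b : ℕ+) {p : ℕ+ × ℕ+} (hp : p.1 < p.2) :
    pairMap (Equiv.swap a b) (pairMap (Equiv.swap a b) p) = p := by
  by_cases h : Equiv.swap a b p.1 < Equiv.swap a b p.2
  · simp [pairMap, h, hp]
  · simp [pairMap, h]

theorem swap_reverses {a b i j : ℕ+} (hab : a < b) (hij : i < j)
    (h : ¬ Equiv.swap a b i < Equiv.swap a b j) :
    (i = a ∧ j = b) ∨ (i = a ∧ a < j ∧ j < b ∧ j ≠ a) ∨ (j = b ∧ a < i ∧ i < b) := by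
  simp only [Equiv.swap_apply_def] at h
  split_ifs at h <;> grind

theorem image_pairMap_subset {u : Equiv.Perm ℕ+} {a b : ℕ+} (hab : a < b) (huab : u a < u b) :
    pairMap (Equiv.swap a b) '' inversions u ⊆
      inversions (u * Equiv.swap a b) \ {(a, b)} := by
  rintro _ ⟨⟨i, j⟩, ⟨hij, hu⟩, rfl⟩
  simp only at hij hu
  by_cases h : Equiv.swap a b i < Equiv.swap a b j
  · refine ⟨by simpa [pairMap, h, inversions] using hu, fun he => ?_⟩
    simp only [pairMap, h, if_true, Set.mem_singleton_iff, Prod.mk.injEq] at he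
    rw [Equiv.swap_apply_eq_iff, Equiv.swap_apply_eq_iff, Equiv.swap_apply_left,
      Equiv.swap_apply_right] at he
    grind
  · have hs := swap_reverses hab hij h
    simp only [pairMap, h, if_false, inversions, Set.mem_sdiff, Set.mem_ofPred_eq,
      Equiv.Perm.mul_apply, Set.mem_singleton_iff, Prod.mk.injEq]
    refine ⟨⟨hij, ?_⟩, by grind⟩
    simp only [Equiv.swap_apply_def]
    grind

theorem injOn_pairMap (u : Equiv.Perm ℕ+) (a b : ℕ+) :
    Set.InjOn (pairMap (Equiv.swap a b)) (inversions u) := by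
  intro p hp q hq h
  rw [← pairMap_swap_pairMap_swap a b hp.1, h, pairMap_swap_pairMap_swap a b hq.1]

theorem len_mul_swap_eq_iff {u : Equiv.Perm ℕ+} (hu : finSupp u) {a b : ℕ+} (hab : a < b)
    (huab : u a < u b) :
    len (u * Equiv.swap a b) = len u + 1 ↔
      pairMap (Equiv.swap a b) '' inversions u = inversions (u * Equiv.swap a b) \ {(a, b)} := by
  have hfin := finite_inversions (finSupp_mul_swap hu a b)
  have hmem : (a, b) ∈ inversions (u * Equiv.swap a b) := by simpa [inversions, hab] using huab
  have h1 : (pairMap (Equiv.swap a b) '' inversions u).ncard = len u :=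
    (injOn_pairMap u a b).ncard_image
  have h2 : (inversions (u * Equiv.swap a b) \ {(a, b)}).ncard + 1 = len (u * Equiv.swap a b) :=
    Set.ncard_sdiff_singleton_add_one hmem hfin
  constructor
  · intro h
    exact Set.eq_of_subset_of_ncard_le (image_pairMap_subset hab huab) (by omega) hfin.sdiff
  · intro h
    rw [← h2, ← h, h1]

theorem len_lt_len_mul_swap {u : Equiv.Perm ℕ+} (hu : finSupp u) {a b : ℕ+} (hab : a < b)
    (huab : u a < u b) : len u < len (u * Equiv.swap a b) := by
  have hfin := finite_inversions (finSupp_mul_swap hu a b)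
  have hmem : (a, b) ∈ inversions (u * Equiv.swap a b) := by simpa [inversions, hab] using huab
  have h1 : (pairMap (Equiv.swap a b) '' inversions u).ncard = len u :=
    (injOn_pairMap u a b).ncard_image
  have h2 : (inversions (u * Equiv.swap a b) \ {(a, b)}).ncard + 1 = len (u * Equiv.swap a b) :=
    Set.ncard_sdiff_singleton_add_one hmem hfin
  have h3 := Set.ncard_le_ncard (image_pairMap_subset hab huab) hfin.sdiff
  omega

/-- Covers by a transposition are characterised by the absence of an intermediate value. -/
theorem len_mul_swap_eq_add_one_iff {u : Equiv.Perm ℕ+} (hu : finSupp u) {a b : ℕ+}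
    (hab : a < b) :
    len (u * Equiv.swap a b) = len u + 1 ↔
      u a < u b ∧ ∀ c, a < c → c < b → u a < u c → ¬ u c < u b := by
  constructor
  · intro h
    have huab : u a < u b := by
      by_contra! hle
      have hlt : u b < u a := lt_of_le_of_ne hle (u.injective.ne hab.ne')
      have := len_lt_len_mul_swap (finSupp_mul_swap hu a b) hab (by simpa using hlt)
      rw [mul_assoc, Equiv.swap_mul_self, mul_one] at this
      omega
    refine ⟨huab, fun c hac hcb h1 h2 => ?_⟩
    rw [len_mul_swap_eq_iff hu hab huab] at h
    have hsc : Equiv.swap a b c = c := Equiv.swap_apply_of_ne_of_ne hac.ne' hcb.ne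
    have hmem : (a, c) ∈ inversions (u * Equiv.swap a b) \ {(a, b)} := by
      simp [inversions, hac, hsc, h2, hcb.ne]
    rw [← h] at hmem
    obtain ⟨p, hp, hpe⟩ := hmem
    have hp' := pairMap_swap_pairMap_swap a b hp.1
    rw [hpe] at hp'
    simp only [pairMap, Equiv.swap_apply_left, hsc, not_lt.2 hcb.le, if_false] at hp'
    subst hp'
    exact absurd hp.2 (not_lt.2 h1.le)
  · rintro ⟨huab, hno⟩
    rw [len_mul_swap_eq_iff hu hab huab]
    refine (image_pairMap_subset hab huab).antisymm ?_
    rintro ⟨i, j⟩ ⟨⟨hij, hw⟩, hne⟩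
    refine ⟨pairMap (Equiv.swap a b) (i, j), ?_, pairMap_swap_pairMap_swap a b hij⟩
    simp only at hij hw
    by_cases h : Equiv.swap a b i < Equiv.swap a b j
    · simpa [pairMap, h, inversions] using hw
    · have hs := swap_reverses hab hij h
      simp only [Set.mem_singleton_iff, Prod.mk.injEq] at hne
      simp only [pairMap, h, if_false, inversions, Set.mem_ofPred_eq]
      refine ⟨hij, ?_⟩
      rw [Equiv.Perm.mul_apply, Equiv.Perm.mul_apply] at hw
      rcases hs with hs | ⟨rfl, h1, h2, h3⟩ | ⟨rfl, h1, h2⟩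
      · exact absurd hs hne
      · rw [Equiv.swap_apply_left, Equiv.swap_apply_of_ne_of_ne h3 h2.ne] at hw
        exact lt_of_le_of_ne (not_lt.1 fun hlt => hno j h1 h2 hlt hw) (u.injective.ne h3)
      · rw [Equiv.swap_apply_right, Equiv.swap_apply_of_ne_of_ne h1.ne' h2.ne] at hw
        exact lt_of_le_of_ne (not_lt.1 fun hlt => hno i h1 h2 hw hlt) (u.injective.ne h2.ne')

/-- The pointwise criterion for the `k`-Bruhat order. -/
structure Criterion (k : ℕ) (u w : Equiv.Perm ℕ+) : Prop where
  le : ∀ a : ℕ+, (a : ℕ) ≤ k → u a ≤ w a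
  ge : ∀ b : ℕ+, k < (b : ℕ) → w b ≤ u b
  lt_left : ∀ a b : ℕ+, a < b → (b : ℕ) ≤ k → u a < u b → w a < w b
  lt_right : ∀ a b : ℕ+, a < b → k < (a : ℕ) → u a < u b → w a < w b

theorem Criterion.refl (k : ℕ) (u : Equiv.Perm ℕ+) : Criterion k u u :=
  ⟨fun _ _ => le_rfl, fun _ _ => le_rfl, fun _ _ _ _ h => h, fun _ _ _ _ h => h⟩

theorem Criterion.trans {k : ℕ} {u v w : Equiv.Perm ℕ+} (h : Criterion k u v)
    (h' : Criterion k v w) : Criterion k u w :=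
  ⟨fun a ha => (h.le a ha).trans (h'.le a ha), fun b hb => (h'.ge b hb).trans (h.ge b hb),
    fun a b hab hb hu => h'.lt_left a b hab hb (h.lt_left a b hab hb hu),
    fun a b hab ha hu => h'.lt_right a b hab ha (h.lt_right a b hab ha hu)⟩

theorem criterion_of_cover {k : ℕ} {u w : Equiv.Perm ℕ+} (hu : finSupp u)
    (h : kBruhatCover k u w) : Criterion k u w := by
  obtain ⟨a, b, ha, hb, rfl, hlen⟩ := h
  have hab : a < b := PNat.coe_lt_coe _ _ |>.1 (ha.trans_lt hb)
  obtain ⟨huab, hno⟩ := (len_mul_swap_eq_add_one_iff hu hab).1 hlen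
  have hinj : ∀ i j, u i = u j → i = j := fun i j => u.injective.eq_iff.1
  constructor
  · intro i hi
    rw [Equiv.Perm.mul_apply, Equiv.swap_apply_def]
    split_ifs with h1 h2
    · exact h1 ▸ huab.le
    · subst h2; omega
    · exact le_rfl
  · intro i hi
    rw [Equiv.Perm.mul_apply, Equiv.swap_apply_def]
    split_ifs with h1 h2
    · subst h1; omega
    · exact h2 ▸ huab.le
    · exact le_rfl
  · intro i j hij hj hlt
    have hjb : j < b := PNat.coe_lt_coe _ _ |>.1 (hj.trans_lt hb)
    rw [Equiv.Perm.mul_apply, Equiv.Perm.mul_apply, Equiv.swap_apply_def, Equiv.swap_apply_def]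
    grind
  · intro i j hij hi hlt
    have hai : a < i := PNat.coe_lt_coe _ _ |>.1 (ha.trans_lt hi)
    rw [Equiv.Perm.mul_apply, Equiv.Perm.mul_apply, Equiv.swap_apply_def, Equiv.swap_apply_def]
    grind

theorem criterion_of_kBruhatLE {k : ℕ} {u w : Equiv.Perm ℕ+} (hu : finSupp u)
    (h : kBruhatLE k u w) : Criterion k u w := by
  induction h with
  | refl => exact Criterion.refl k u
  | tail huv hc ih => exact ih.trans (criterion_of_cover (finSupp_of_kBruhatLE hu huv) hc)

theorem eq_of_forall_le {u w : Equiv.Perm ℕ+} (h : ∀ i, w i ≤ u i) : w = u := by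
  suffices H : ∀ x i, u i = x → w i = x from Equiv.ext fun i => H _ i rfl
  intro x
  induction x using WellFoundedLT.induction with
  | ind x ih =>
    rintro i rfl
    by_contra hne
    have hlt : w i < u i := lt_of_le_of_ne (h i) hne
    have := ih _ hlt (u.symm (w i)) (by simp)
    have hi := w.injective this
    rw [Equiv.symm_apply_eq] at hi
    exact hne hi

/-- If `a` is the position `≤ k` of the largest entry that still has to grow, some entry at a
position `> k` can be exchanged with it. -/
theorem Criterion.exists_exchange {k : ℕ} {u w : Equiv.Perm ℕ+} (h : Criterion k u w) {a : ℕ+}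
    (ha : u a < w a)
    (hmax : ∀ i : ℕ+, (i : ℕ) ≤ k → u a < u i → w i = u i) :
    ∃ b : ℕ+, k < (b : ℕ) ∧ w b ≤ u a ∧ u a < u b ∧ u b ≤ w a := by
  let S : Set ℕ+ := {x | u a < x ∧ x ≤ w a ∧ w (u.symm x) ≠ x}
  have hS : S.Nonempty := by
    refine ⟨w a, ha, le_rfl, fun he => ?_⟩
    have := w.injective he
    rw [Equiv.symm_apply_eq] at this
    exact ha.ne' this
  obtain ⟨x, ⟨hx1, hx2, hx3⟩, hmin⟩ := WellFounded.has_min wellFounded_lt S hS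
  have hux : u (u.symm x) = x := u.apply_symm_apply x
  have hb : k < (u.symm x : ℕ) := by
    by_contra! hle
    exact hx3 ((hmax _ hle (by rwa [hux])).trans hux)
  have hlt : w (u.symm x) < x := lt_of_le_of_ne ((h.ge _ hb).trans hux.le) hx3
  refine ⟨u.symm x, hb, ?_, by rwa [hux], by rwa [hux]⟩
  by_contra! hgt
  refine hmin _ ⟨hgt, hlt.le.trans hx2, fun he => ?_⟩ hlt
  have := w.injective he
  rw [Equiv.symm_apply_eq, hux] at this
  exact hx3 this

theorem Criterion.exists_cover {k : ℕ} {u w : Equiv.Perm ℕ+} (hu : finSupp u)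
    (h : Criterion k u w) (hne : u ≠ w) :
    ∃ a b : ℕ+, (a : ℕ) ≤ k ∧ k < (b : ℕ) ∧ u a < u b ∧
      kBruhatCover k u (u * Equiv.swap a b) ∧ Criterion k (u * Equiv.swap a b) w := by
  let A : Set ℕ+ := {i | (i : ℕ) ≤ k ∧ u i < w i}
  have hAfin : A.Finite :=
    ((Set.finite_Iic k).preimage PNat.coe_injective.injOn).subset fun i hi => hi.1
  have hAne : A.Nonempty := by
    by_contra hA
    refine hne (eq_of_forall_le fun i => ?_).symm
    by_cases hi : (i : ℕ) ≤ k
    · by_contra! hlt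
      exact hA ⟨i, hi, hlt⟩
    · exact h.ge i (not_le.1 hi)
  obtain ⟨a, ⟨hak, haw⟩, hAmax⟩ := hAfin.exists_maximalFor u A hAne
  have hmax : ∀ i : ℕ+, (i : ℕ) ≤ k → u a < u i → w i = u i := by
    intro i hi hlt
    by_contra hne'
    have := hAmax ⟨hi, lt_of_le_of_ne (h.le i hi) (Ne.symm hne')⟩ hlt.le
    exact absurd hlt (not_lt.2 this)
  let B : Set ℕ+ := {b | k < (b : ℕ) ∧ w b ≤ u a ∧ u a < u b ∧ u b ≤ w a}
  obtain ⟨b, ⟨hbk, hwb, hab', hbw⟩, hBmin⟩ :=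
    WellFounded.has_min (InvImage.wf u wellFounded_lt) B (h.exists_exchange haw hmax)
  have hmin : ∀ c : ℕ+, k < (c : ℕ) → u a < u c → u c < u b → u a < w c := by
    intro c hc h1 h2
    by_contra! h3
    exact hBmin c ⟨hc, h3, h1, h2.le.trans hbw⟩ h2
  have hab : a < b := PNat.coe_lt_coe _ _ |>.1 (hak.trans_lt hbk)
  refine ⟨a, b, hak, hbk, hab', ⟨a, b, hak, hbk, rfl, ?_⟩, ?_⟩
  · refine (len_mul_swap_eq_add_one_iff hu hab).2 ⟨hab', fun c hac hcb h1 h2 => ?_⟩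
    by_cases hc : (c : ℕ) ≤ k
    · have h3 := h.lt_left a c hac hc h1
      rw [hmax c hc h1] at h3
      exact absurd (h3.trans h2) (not_lt.2 hbw)
    · have h3 := h.lt_right c b hcb (not_le.1 hc) h2
      exact absurd (hmin c (not_le.1 hc) h1 h2) (not_lt.2 (h3.le.trans hwb))
  · constructor
    · intro i hi
      have hle := h.le i hi
      rw [Equiv.Perm.mul_apply, Equiv.swap_apply_def]
      split_ifs with h1 h2
      · exact h1 ▸ hbw
      · subst h2; omega
      · exact hle
    · intro i hi
      have hge := h.ge i hi
      rw [Equiv.Perm.mul_apply, Equiv.swap_apply_def]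
      split_ifs with h1 h2
      · subst h1; omega
      · exact h2 ▸ hwb
      · exact hge
    · intro i j hij hj
      have hlt := h.lt_left i j hij hj
      have hmi := hmax i (((PNat.coe_lt_coe _ _).2 hij).le.trans hj)
      have hjb : j < b := PNat.coe_lt_coe _ _ |>.1 (hj.trans_lt hbk)
      have hinj : u i = u a → i = a := fun h => u.injective h
      have hib : i ≠ b := (hij.trans hjb).ne
      rw [Equiv.Perm.mul_apply, Equiv.Perm.mul_apply]
      intro hlt'
      rcases eq_or_ne j a with rfl | hja
      · rw [Equiv.swap_apply_left, Equiv.swap_apply_of_ne_of_ne hij.ne hib] at hlt'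
        rcases lt_or_ge (u j) (u i) with h1 | h1
        · exact (hmi h1).trans_lt (hlt'.trans_le hbw)
        · exact hlt (lt_of_le_of_ne h1 fun he => hij.ne (hinj he))
      · rw [Equiv.swap_apply_of_ne_of_ne hja hjb.ne] at hlt'
        rcases eq_or_ne i a with rfl | hia
        · rw [Equiv.swap_apply_left] at hlt'
          exact hlt (hab'.trans hlt')
        · rw [Equiv.swap_apply_of_ne_of_ne hia hib] at hlt'
          exact hlt hlt'
    · intro i j hij hi
      have hlt := h.lt_right i j hij hi
      have hmj := hmin j (hi.trans ((PNat.coe_lt_coe _ _).2 hij))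
      have hai : a < i := PNat.coe_lt_coe _ _ |>.1 (hak.trans_lt hi)
      have hinj : u j = u b → j = b := fun h => u.injective h
      have hja : j ≠ a := (hai.trans hij).ne'
      rw [Equiv.Perm.mul_apply, Equiv.Perm.mul_apply]
      intro hlt'
      rcases eq_or_ne i b with rfl | hib
      · rw [Equiv.swap_apply_right, Equiv.swap_apply_of_ne_of_ne hja hij.ne'] at hlt'
        rcases lt_or_ge (u j) (u i) with h1 | h1
        · exact hwb.trans_lt (hmj hlt' h1)
        · exact hlt (lt_of_le_of_ne h1 fun he => hij.ne (hinj he.symm).symm)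
      · rw [Equiv.swap_apply_of_ne_of_ne hai.ne' hib] at hlt'
        rcases eq_or_ne j b with rfl | hjb
        · rw [Equiv.swap_apply_right] at hlt'
          exact hlt (hlt'.trans hab')
        · rw [Equiv.swap_apply_of_ne_of_ne hja hjb] at hlt'
          exact hlt hlt'

theorem kBruhatLE_of_criterion {k : ℕ} {u w : Equiv.Perm ℕ+} (hu : finSupp u)
    (h : Criterion k u w) : kBruhatLE k u w := by
  induction hn : ∑ i ∈ Finset.range k, ((w i.succPNat : ℕ) - (u i.succPNat : ℕ))
    using Nat.strong_induction_on generalizing u with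
  | _ n ih =>
    by_cases hne : u = w
    · exact hne ▸ Relation.ReflTransGen.refl
    obtain ⟨a, b, ha, hb, hab, hcov, hcrit⟩ := h.exists_cover hu hne
    refine Relation.ReflTransGen.head hcov (ih _ ?_ (finSupp_mul_swap hu a b) hcrit rfl)
    rw [← hn]
    have hsucc : a.natPred.succPNat = a := PNat.succPNat_natPred a
    refine Finset.sum_lt_sum (fun i hi => ?_) ⟨a.natPred, ?_, ?_⟩
    · have hik : (i.succPNat : ℕ) ≤ k := by simpa using hi
      refine Nat.sub_le_sub_left ?_ _
      rw [PNat.coe_le_coe, Equiv.Perm.mul_apply, Equiv.swap_apply_def]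
      split_ifs with h1 h2
      · exact h1 ▸ hab.le
      · rw [h2] at hik; omega
      · exact le_rfl
    · have := PNat.natPred_add_one a
      rw [Finset.mem_range]
      omega
    · rw [hsucc]
      have h1 : (u b : ℕ) ≤ w a := by simpa using hcrit.le a ha
      have h2 : (u a : ℕ) < u b := hab
      simp only [Equiv.Perm.mul_apply, Equiv.swap_apply_left]
      omega

/-- The criterion, for `u` and `ζ * u`, transfers to the left factors `η` lying below `ζ` for
another permutation `x` and another integer `l`. -/
theorem Criterion.transfer {k l : ℕ} {η ζ u x : Equiv.Perm ℕ+} (h : Criterion k u (ζ * u))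
    (h₁ : Criterion l x (η * x)) (h₂ : Criterion l (η * x) (ζ * x)) :
    Criterion k u (η * u) ∧ Criterion k (η * u) (ζ * u) := by
  have hval : ∀ v : ℕ+, (((x.symm v : ℕ+) : ℕ) ≤ l ∧ v ≤ η v ∧ η v ≤ ζ v) ∨
      (l < ((x.symm v : ℕ+) : ℕ) ∧ η v ≤ v ∧ ζ v ≤ η v) := by
    intro v
    rcases le_or_gt ((x.symm v : ℕ+) : ℕ) l with hv | hv
    · exact Or.inl ⟨hv, by simpa using h₁.le _ hv, by simpa using h₂.le _ hv⟩
    · exact Or.inr ⟨hv, by simpa using h₁.ge _ hv, by simpa using h₂.ge _ hv⟩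
  have hmono : ∀ v v' : ℕ+, v < v' → ζ v < ζ v' →
      (((x.symm v : ℕ+) : ℕ) ≤ l ↔ ((x.symm v' : ℕ+) : ℕ) ≤ l) → η v < η v' := by
    intro v v' hlt hζ hiff
    have hηne : η v ≠ η v' := η.injective.ne hlt.ne
    rcases lt_trichotomy (x.symm v) (x.symm v') with hp | hp | hp
    · by_cases hl : ((x.symm v' : ℕ+) : ℕ) ≤ l
      · simpa using h₁.lt_left _ _ hp hl (by simpa using hlt)
      · simpa using h₁.lt_right _ _ hp (not_le.1 (mt hiff.1 hl)) (by simpa using hlt)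
    · exact absurd (x.symm.injective hp) hlt.ne
    · by_contra hnot
      have hgt : η v' < η v := lt_of_le_of_ne (not_lt.1 hnot) hηne.symm
      refine absurd hζ (not_lt.2 (le_of_lt ?_))
      by_cases hl : ((x.symm v : ℕ+) : ℕ) ≤ l
      · simpa using h₂.lt_left _ _ hp hl (by simpa using hgt)
      · simpa using h₂.lt_right _ _ hp (not_le.1 (mt hiff.2 hl)) (by simpa using hgt)
  have hmono' : ∀ v v' : ℕ+, v' < v → η v < η v' →
      (((x.symm v : ℕ+) : ℕ) ≤ l ↔ ((x.symm v' : ℕ+) : ℕ) ≤ l) → ζ v < ζ v' := by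
    intro v v' hlt hη hiff
    by_contra hnot
    have hgt : ζ v' < ζ v := lt_of_le_of_ne (not_lt.1 hnot) (ζ.injective.ne hlt.ne)
    exact absurd (hmono v' v hlt hgt hiff.symm) (not_lt.2 hη.le)
  refine ⟨⟨fun a ha => ?_, fun b hb => ?_, fun a b hab hb hlt => ?_, fun a b hab ha hlt => ?_⟩,
    ⟨fun a ha => ?_, fun b hb => ?_, fun a b hab hb hlt => ?_, fun a b hab ha hlt => ?_⟩⟩
  · have h1 := h.le a ha
    have h2 := hval (u a)
    simp only [Equiv.Perm.mul_apply] at h1 ⊢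
    grind
  · have h1 := h.ge b hb
    have h2 := hval (u b)
    simp only [Equiv.Perm.mul_apply] at h1 ⊢
    grind
  · have h1 := h.le a (((PNat.coe_lt_coe _ _).2 hab).le.trans hb)
    have h2 := h.le b hb
    have h3 := h.lt_left a b hab hb hlt
    have h4 := hval (u a)
    have h5 := hval (u b)
    have h6 := hmono (u a) (u b) hlt h3
    simp only [Equiv.Perm.mul_apply] at h1 h2 h3 ⊢
    grind
  · have h1 := h.ge a ha
    have h2 := h.ge b (ha.trans ((PNat.coe_lt_coe _ _).2 hab))
    have h3 := h.lt_right a b hab ha hlt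
    have h4 := hval (u a)
    have h5 := hval (u b)
    have h6 := hmono (u a) (u b) hlt h3
    simp only [Equiv.Perm.mul_apply] at h1 h2 h3 ⊢
    grind
  · have h1 := h.le a ha
    have h2 := hval (u a)
    simp only [Equiv.Perm.mul_apply] at h1 ⊢
    grind
  · have h1 := h.ge b hb
    have h2 := hval (u b)
    simp only [Equiv.Perm.mul_apply] at h1 ⊢
    grind
  · have h1 := h.le a (((PNat.coe_lt_coe _ _).2 hab).le.trans hb)
    have h2 := h.le b hb
    have h3 := h.lt_left a b hab hb
    have h4 := hval (u a)
    have h5 := hval (u b)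
    have h6 := hmono' (u a) (u b)
    have h7 : u a ≠ u b := u.injective.ne hab.ne
    simp only [Equiv.Perm.mul_apply] at h1 h2 h3 hlt ⊢
    grind
  · have h1 := h.ge a ha
    have h2 := h.ge b (ha.trans ((PNat.coe_lt_coe _ _).2 hab))
    have h3 := h.lt_right a b hab ha
    have h4 := hval (u a)
    have h5 := hval (u b)
    have h6 := hmono' (u a) (u b)
    have h7 : u a ≠ u b := u.injective.ne hab.ne
    simp only [Equiv.Perm.mul_apply] at h1 h2 h3 hlt ⊢
    grind

theorem kBruhatLE_of_preceq {k : ℕ} {η ζ u : Equiv.Perm ℕ+} (hu : finSupp u)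
    (h : kBruhatLE k u (ζ * u)) (hηζ : preceq η ζ) :
    kBruhatLE k u (η * u) ∧ kBruhatLE k (η * u) (ζ * u) := by
  obtain ⟨l, -, x, hx, h₁, h₂⟩ := hηζ
  obtain ⟨c₁, c₂⟩ := (criterion_of_kBruhatLE hu h).transfer (criterion_of_kBruhatLE hx h₁)
    (criterion_of_kBruhatLE (finSupp_of_kBruhatLE hx h₁) h₂)
  have hle := kBruhatLE_of_criterion hu c₁
  exact ⟨hle, kBruhatLE_of_criterion (finSupp_of_kBruhatLE hu hle) c₂⟩

end KBruhat

/-- Theorem 3.2.3(iii): if `u ≤_k ζ∘u`, then `η ↦ η∘u` is an order isomorphism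
`[e,ζ]_≼ ≅ [u, ζ∘u]_k`. -/
theorem stmt9 (k : ℕ) (hk : 0 < k) (ζ u : Equiv.Perm ℕ+)
    (hζ : finSupp ζ) (hu : finSupp u)
    (h : kBruhatLE k u (ζ * u)) :
    Set.BijOn (fun η => η * u) {η | preceq η ζ}
      {v | kBruhatLE k u v ∧ kBruhatLE k v (ζ * u)} ∧
    ∀ η η' : Equiv.Perm ℕ+, preceq η ζ → preceq η' ζ →
      (preceq η η' ↔ kBruhatLE k (η * u) (η' * u)) := by
  refine ⟨⟨fun η hη => KBruhat.kBruhatLE_of_preceq hu h hη,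
    fun η _ η' _ he => mul_right_cancel he, fun v hv => ⟨v * u⁻¹, ?_, by simp⟩⟩,
    fun η η' hη hη' => ⟨fun hle => ?_, fun hle => ?_⟩⟩
  · exact ⟨k, hk, u, hu, by simpa using hv.1, by simpa using hv.2⟩
  · exact (KBruhat.kBruhatLE_of_preceq hu (KBruhat.kBruhatLE_of_preceq hu h hη').1 hle).2
  · exact ⟨k, hk, u, hu, (KBruhat.kBruhatLE_of_preceq hu h hη).1, hle⟩
end

section
/- Let η, ζ ∈ S_∞ with η ≼ ζ. Then the map ξ ↦ ξ∘η^{-1} is an order isomorphism from [η,ζ]_≼ := {ξ : η ≼ ξ ≼ ζ} onto [e, ζ∘η^{-1}]_≼ := {χ : χ ≼ ζ∘η^{-1}}: it is a bijection between these sets, and for all ξ, ξ' ∈ [η,ζ]_≼ one has ξ ≼ ξ' if and only if ξ∘η^{-1} ≼ ξ'∘η^{-1}. -/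
/-- The set of inversions of `w`. -/
def inversions (w : Equiv.Perm ℕ+) : Set (ℕ+ × ℕ+) := {p | p.1 < p.2 ∧ w p.2 < w p.1}

theorem len_eq_ncard_inversions (w : Equiv.Perm ℕ+) : len w = (inversions w).ncard := rfl

theorem finSupp.mul {u v : Equiv.Perm ℕ+} (hu : finSupp u) (hv : finSupp v) :
    finSupp (u * v) := by
  refine (hu.union hv).subset fun i hi => ?_
  simp only [Set.mem_ofPred_eq, Set.mem_union, Equiv.Perm.mul_apply] at hi ⊢
  by_contra! h
  exact hi (by rw [h.2, h.1])

theorem finSupp.inv {u : Equiv.Perm ℕ+} (hu : finSupp u) : finSupp u⁻¹ := by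
  refine hu.subset fun i hi => ?_
  simp only [Set.mem_ofPred_eq, ne_eq, Equiv.Perm.inv_eq_iff_eq] at hi ⊢
  exact fun h => hi h.symm

theorem finSupp_swap (a b : ℕ+) : finSupp (Equiv.swap a b) := by
  refine (Set.toFinite {a, b}).subset fun i hi => ?_
  by_contra h
  simp only [Set.mem_insert_iff, Set.mem_singleton_iff, not_or] at h
  exact hi (Equiv.swap_apply_of_ne_of_ne h.1 h.2)

theorem finite_inversions {w : Equiv.Perm ℕ+} (hw : finSupp w) : (inversions w).Finite := by
  obtain ⟨N, hN⟩ := hw.bddAbove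
  refine ((Set.finite_Iic N).prod (Set.finite_Iic N)).subset ?_
  rintro ⟨i, j⟩ ⟨hij, hw'⟩
  simp only at hij hw'
  have hfix : ∀ m, N < m → w m = m := fun m hm => by
    by_contra h
    exact absurd (hN h) (not_le.mpr hm)
  have hj : j ≤ N := by
    by_contra! hj
    rw [hfix j hj] at hw'
    have := w.injective (hfix _ (hj.trans hw'))
    rw [this] at hw'
    exact absurd hij hw'.asymm
  exact ⟨hij.le.trans hj, hj⟩

/-- The action of `swap a b` on pairs of positions, except that pairs whose order it would
reverse are left alone. -/
def swapPair (a b : ℕ+) (p : ℕ+ × ℕ+) : ℕ+ × ℕ+ :=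
  if Equiv.swap a b p.1 < Equiv.swap a b p.2 then (Equiv.swap a b p.1, Equiv.swap a b p.2) else p

theorem swapPair_injOn (a b : ℕ+) : Set.InjOn (swapPair a b) {p | p.1 < p.2} := by
  rintro ⟨i, j⟩ hij ⟨i', j'⟩ hij' h
  simp only [Set.mem_ofPred_eq] at hij hij'
  simp only [swapPair] at h
  split_ifs at h with h1 h2 h2
  · simpa using h
  · simp only [Prod.mk.injEq] at h
    rw [← h.1, ← h.2] at h2
    simp [hij] at h2
  · simp only [Prod.mk.injEq] at h
    rw [h.1, h.2] at h1
    simp [hij'] at h1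
  · exact h

section Swap

variable {u : Equiv.Perm ℕ+} {a b : ℕ+}

theorem swapPair_mem_inversions (hab : a < b) (hu : u a < u b) {p : ℕ+ × ℕ+}
    (hp : p ∈ inversions u) : swapPair a b p ∈ inversions (u * Equiv.swap a b) := by
  obtain ⟨i, j⟩ := p
  obtain ⟨hij, hji⟩ := hp
  simp only at hij hji
  unfold swapPair
  split_ifs with h
  · exact ⟨h, by simpa using hji⟩
  · refine ⟨hij, ?_⟩
    simp only [Equiv.Perm.mul_apply, Equiv.swap_apply_def] at h ⊢
    grind

theorem mem_inversions_mul_swap (hab : a < b) (hu : u a < u b) :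
    (a, b) ∈ inversions (u * Equiv.swap a b) :=
  ⟨hab, by simpa using hu⟩

theorem left_notMem_image_swapPair {c : ℕ+} (hac : a < c) (hcb : c ≤ b) (hu : u a < u c) :
    (a, c) ∉ swapPair a b '' inversions u := by
  rintro ⟨⟨i, j⟩, ⟨hij, hji⟩, h⟩
  simp only at hij hji
  simp only [swapPair, Equiv.swap_apply_def] at h
  grind

theorem len_add_one_le (hfin : finSupp u) (hab : a < b) (hu : u a < u b) :
    len u + 1 ≤ len (u * Equiv.swap a b) := by
  have hinj : Set.InjOn (swapPair a b) (inversions u) :=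
    (swapPair_injOn a b).mono fun p hp => hp.1
  have hfi := (finite_inversions hfin).image (swapPair a b)
  rw [len_eq_ncard_inversions, len_eq_ncard_inversions, ← hinj.ncard_image,
    ← Set.ncard_insert_of_notMem (left_notMem_image_swapPair hab le_rfl hu) hfi]
  refine Set.ncard_le_ncard (Set.insert_subset (mem_inversions_mul_swap hab hu) ?_)
    (finite_inversions (hfin.mul (finSupp_swap a b)))
  rintro _ ⟨p, hp, rfl⟩
  exact swapPair_mem_inversions hab hu hp

theorem len_add_two_le (hfin : finSupp u) {c : ℕ+} (hac : a < c) (hcb : c < b)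
    (hu : u a < u c) (hu' : u c < u b) : len u + 2 ≤ len (u * Equiv.swap a b) := by
  have hab := hac.trans hcb
  have hinj : Set.InjOn (swapPair a b) (inversions u) :=
    (swapPair_injOn a b).mono fun p hp => hp.1
  have hfi := (finite_inversions hfin).image (swapPair a b)
  have hmem : (a, c) ∉ insert (a, b) (swapPair a b '' inversions u) := by
    rintro (h | h)
    · exact hcb.ne (congrArg Prod.snd h)
    · exact left_notMem_image_swapPair hac hcb.le hu h
  rw [len_eq_ncard_inversions, len_eq_ncard_inversions, ← hinj.ncard_image,
    ← one_add_one_eq_two, ← add_assoc,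
    ← Set.ncard_insert_of_notMem (left_notMem_image_swapPair hab le_rfl (hu.trans hu')) hfi,
    ← Set.ncard_insert_of_notMem hmem (hfi.insert _)]
  refine Set.ncard_le_ncard (Set.insert_subset ⟨hac, ?_⟩
    (Set.insert_subset (mem_inversions_mul_swap hab (hu.trans hu')) ?_))
    (finite_inversions (hfin.mul (finSupp_swap a b)))
  · simpa [Equiv.swap_apply_of_ne_of_ne hac.ne' hcb.ne] using hu'
  · rintro _ ⟨p, hp, rfl⟩
    exact swapPair_mem_inversions hab (hu.trans hu') hp

theorem len_mul_swap_eq (hfin : finSupp u) (hab : a < b) (hu : u a < u b)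
    (hc : ∀ c, a < c → c < b → u a < u c → ¬ u c < u b) :
    len (u * Equiv.swap a b) = len u + 1 := by
  have hinj : Set.InjOn (swapPair a b) (inversions u) :=
    (swapPair_injOn a b).mono fun p hp => hp.1
  have hfi := (finite_inversions hfin).image (swapPair a b)
  refine le_antisymm ?_ (len_add_one_le hfin hab hu)
  rw [len_eq_ncard_inversions, len_eq_ncard_inversions, ← hinj.ncard_image,
    ← Set.ncard_insert_of_notMem (left_notMem_image_swapPair hab le_rfl hu) hfi]
  refine Set.ncard_le_ncard ?_ (hfi.insert _)
  rintro ⟨i, j⟩ ⟨hij, hji⟩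
  simp only [Equiv.Perm.mul_apply] at hij hji
  rw [Set.mem_insert_iff, or_iff_not_imp_left]
  intro hne
  by_cases h : Equiv.swap a b i < Equiv.swap a b j
  · exact ⟨(Equiv.swap a b i, Equiv.swap a b j), ⟨h, hji⟩, by simp [swapPair, hij]⟩
  · refine ⟨(i, j), ⟨hij, ?_⟩, by simp [swapPair, h]⟩
    have hne' : ∀ s t, s ≠ t → u s ≠ u t := fun s t => u.injective.ne
    simp only [Prod.mk.injEq] at hne
    rcases eq_or_ne i a with rfl | hia
    · have hjb : j ≠ b := fun h => hne ⟨rfl, h⟩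
      simp only [Equiv.swap_apply_left, Equiv.swap_apply_of_ne_of_ne hij.ne' hjb] at h hji
      exact lt_of_le_of_ne (not_lt.1 fun h' => hc j hij (lt_of_le_of_ne (not_lt.1 h) hjb) h' hji)
        (hne' _ _ hij.ne')
    · rcases eq_or_ne j b with rfl | hjb
      · simp only [Equiv.swap_apply_right, Equiv.swap_apply_of_ne_of_ne hia hij.ne] at h hji
        exact lt_of_le_of_ne (not_lt.1 fun h' =>
          hc i (lt_of_le_of_ne (not_lt.1 h) hia.symm) hij hji h') (hne' _ _ hij.ne')
      · simp only [Equiv.swap_apply_def] at h hji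
        grind

/-- Multiplying on the right by `swap a b` raises the length by one iff the values at `a`, `b`
are in order and no intermediate position has an intermediate value. -/
theorem len_mul_swap_eq_iff (hfin : finSupp u) (hab : a < b) :
    len (u * Equiv.swap a b) = len u + 1 ↔
      u a < u b ∧ ∀ c, a < c → c < b → u a < u c → ¬ u c < u b := by
  refine ⟨fun h => ?_, fun h => len_mul_swap_eq hfin hab h.1 h.2⟩
  have hu : u a < u b := by
    by_contra! hle
    have hlt := lt_of_le_of_ne hle fun h => hab.ne' (u.injective h)
    have := len_add_one_le (hfin.mul (finSupp_swap a b)) hab (by simpa using hlt)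
    rw [mul_assoc, Equiv.swap_mul_self, mul_one] at this
    omega
  refine ⟨hu, fun c hac hcb h1 h2 => ?_⟩
  have := len_add_two_le hfin hac hcb h1 h2
  omega

end Swap

theorem kBruhatCover_iff {k : ℕ} {u w : Equiv.Perm ℕ+} (hu : finSupp u) :
    kBruhatCover k u w ↔ ∃ a b : ℕ+, (a : ℕ) ≤ k ∧ k < (b : ℕ) ∧ w = u * Equiv.swap a b ∧
      u a < u b ∧ ∀ c, a < c → c < b → u a < u c → ¬ u c < u b := by
  refine exists_congr fun a => exists_congr fun b => and_congr_right fun ha =>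
    and_congr_right fun hb => and_congr_right fun hw => ?_
  rw [hw]
  exact len_mul_swap_eq_iff hu (by exact_mod_cast ha.trans_lt hb)

theorem finSupp_of_kBruhatCover {k : ℕ} {u w : Equiv.Perm ℕ+} (h : kBruhatCover k u w)
    (hu : finSupp u) : finSupp w := by
  obtain ⟨a, b, -, -, rfl, -⟩ := h
  exact hu.mul (finSupp_swap a b)

theorem finSupp_of_kBruhatLE {k : ℕ} {u w : Equiv.Perm ℕ+} (h : kBruhatLE k u w)
    (hu : finSupp u) : finSupp w := by
  induction h with
  | refl => exact hu
  | tail _ h ih => exact finSupp_of_kBruhatCover h ih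

/-- The pointwise necessary conditions for `u ≤_k w`. -/
structure BruhatCriterion (k : ℕ) (u w : Equiv.Perm ℕ+) : Prop where
  le_left : ∀ i : ℕ+, (i : ℕ) ≤ k → u i ≤ w i
  le_right : ∀ i : ℕ+, k < (i : ℕ) → w i ≤ u i
  lt_left : ∀ i j : ℕ+, i < j → (j : ℕ) ≤ k → u i < u j → w i < w j
  lt_right : ∀ i j : ℕ+, i < j → k < (i : ℕ) → u i < u j → w i < w j

theorem BruhatCriterion.of_cover {k : ℕ} {u v w : Equiv.Perm ℕ+} (hu : finSupp u)
    (huv : kBruhatCover k u v) (h : BruhatCriterion k v w) : BruhatCriterion k u w := by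
  obtain ⟨a, b, ha, hb, rfl, hab, hc⟩ := (kBruhatCover_iff hu).1 huv
  obtain ⟨h1, h2, h3, h4⟩ := h
  have hne : ∀ s t, s ≠ t → u s ≠ u t := fun s t => u.injective.ne
  have left : ∀ i : ℕ+, (i : ℕ) ≤ k → i ≠ b := by rintro i hi rfl; omega
  have right : ∀ i : ℕ+, k < (i : ℕ) → i ≠ a := by rintro i hi rfl; omega
  simp only [Equiv.Perm.mul_apply] at h1 h2 h3 h4
  constructor
  · intro i hi
    have := h1 i hi
    rcases eq_or_ne i a with rfl | hia
    · rw [Equiv.swap_apply_left] at this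
      exact hab.le.trans this
    · rwa [Equiv.swap_apply_of_ne_of_ne hia (left i hi)] at this
  · intro i hi
    have := h2 i hi
    rcases eq_or_ne i b with rfl | hib
    · rw [Equiv.swap_apply_right] at this
      exact this.trans hab.le
    · rwa [Equiv.swap_apply_of_ne_of_ne (right i hi) hib] at this
  · intro i j hij hj huij
    have hi : (i : ℕ) ≤ k := (PNat.coe_le_coe i j |>.2 hij.le).trans hj
    have hjb : j < b := PNat.coe_lt_coe j b |>.1 (hj.trans_lt hb)
    refine h3 i j hij hj ?_
    rcases eq_or_ne j a with rfl | hja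
    · rw [Equiv.swap_apply_left, Equiv.swap_apply_of_ne_of_ne hij.ne (left i hi)]
      exact huij.trans hab
    rw [Equiv.swap_apply_of_ne_of_ne hja hjb.ne]
    rcases eq_or_ne i a with rfl | hia
    · rw [Equiv.swap_apply_left]
      exact lt_of_le_of_ne (not_lt.1 (hc j hij hjb huij)) (hne _ _ hjb.ne')
    · rwa [Equiv.swap_apply_of_ne_of_ne hia (left i hi)]
  · intro i j hij hi huij
    have hj : k < (j : ℕ) := hi.trans (PNat.coe_lt_coe i j |>.2 hij)
    have hai : a < i := PNat.coe_lt_coe a i |>.1 (ha.trans_lt hi)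
    refine h4 i j hij hi ?_
    rcases eq_or_ne i b with rfl | hib
    · rw [Equiv.swap_apply_right, Equiv.swap_apply_of_ne_of_ne (right j hj) hij.ne']
      exact hab.trans huij
    rw [Equiv.swap_apply_of_ne_of_ne hai.ne' hib]
    rcases eq_or_ne j b with rfl | hjb
    · rw [Equiv.swap_apply_right]
      exact lt_of_le_of_ne (not_lt.1 fun h => hc i hai hij h huij) (hne _ _ hai.ne')
    · rwa [Equiv.swap_apply_of_ne_of_ne (right j hj) hjb]

theorem kBruhatLE.criterion {k : ℕ} {u w : Equiv.Perm ℕ+} (h : kBruhatLE k u w)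
    (hu : finSupp u) : BruhatCriterion k u w := by
  induction h using Relation.ReflTransGen.head_induction_on with
  | refl => exact ⟨fun _ _ => le_rfl, fun _ _ => le_rfl, fun _ _ _ _ h => h, fun _ _ _ _ h => h⟩
  | head h _ ih => exact .of_cover hu h (ih (finSupp_of_kBruhatCover h hu))

/-- A cover at the bottom of an interval is carried along by a rearrangement `ρ` of the
positions. -/
theorem cover_mul_right {k l : ℕ} {x y z ρ : Equiv.Perm ℕ+} (hx : finSupp x) (hρ : finSupp ρ)
    (hxy : kBruhatCover l x y) (hyz : BruhatCriterion l y z)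
    (h : BruhatCriterion k (x * ρ) (z * ρ)) :
    kBruhatCover k (x * ρ) (y * ρ) ∧ BruhatCriterion k (y * ρ) (z * ρ) := by
  obtain ⟨a, b, ha, hb, rfl, hab, hc⟩ := (kBruhatCover_iff hx).1 hxy
  obtain ⟨r, rfl⟩ : ∃ r, ρ = r⁻¹ := ⟨ρ⁻¹, (inv_inv ρ).symm⟩
  obtain ⟨y1, y2, y3, y4⟩ := hyz
  obtain ⟨h1, h2, h3, h4⟩ := h
  have hr : ∀ i, r⁻¹ (r i) = i := fun i => by simp
  have hne : ∀ s t, s ≠ t → x s ≠ x t := fun s t => x.injective.ne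
  replace h1 : ∀ i, (r i : ℕ) ≤ k → x i ≤ z i := fun i hi => by simpa using h1 (r i) hi
  replace h2 : ∀ i, k < (r i : ℕ) → z i ≤ x i := fun i hi => by simpa using h2 (r i) hi
  replace h3 : ∀ i j, r i < r j → (r j : ℕ) ≤ k → x i < x j → z i < z j :=
    fun i j => by simpa using h3 (r i) (r j)
  replace h4 : ∀ i j, r i < r j → k < (r i : ℕ) → x i < x j → z i < z j :=
    fun i j => by simpa using h4 (r i) (r j)
  simp only [Equiv.Perm.mul_apply] at y1 y2 y3 y4
  have hza : x b ≤ z a := by simpa using y1 a ha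
  have hzb : z b ≤ x a := by simpa using y2 b hb
  have hra : (r a : ℕ) ≤ k := by
    by_contra! hk
    exact absurd (hab.trans_le hza) (h2 a hk).not_gt
  have hrb : k < (r b : ℕ) := by
    by_contra! hk
    exact absurd (hzb.trans_lt hab) (h1 b hk).not_gt
  have hfix : ∀ c, x a < x c → x c < x b → Equiv.swap a b c = c := fun c hac hcb =>
    Equiv.swap_apply_of_ne_of_ne (by rintro rfl; exact hac.false) (by rintro rfl; exact hcb.false)
  have hleft : ∀ c, (r c : ℕ) ≤ k → x a < x c → x c < x b → z c < z a := by
    intro c hck hac hcb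
    by_contra! hle
    have hcl : (c : ℕ) ≤ l := by
      by_contra! hl
      have := y2 c hl
      rw [hfix c hac hcb] at this
      exact absurd (hza.trans (hle.trans this)) hcb.not_ge
    have hca : c < a := by
      rcases lt_trichotomy c a with h | rfl | h
      · exact h
      · exact absurd hac (lt_irrefl _)
      · exact absurd hcb (hc c h (PNat.coe_lt_coe c b |>.1 (hcl.trans_lt hb)) hac)
    refine absurd (y3 c a hca ha ?_) hle.not_gt
    rwa [hfix c hac hcb, Equiv.swap_apply_left]
  have hright : ∀ c, k < (r c : ℕ) → x a < x c → x c < x b → z b < z c := by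
    intro c hck hac hcb
    by_contra! hle
    have hcl : l < (c : ℕ) := by
      by_contra! hl
      have := y1 c hl
      rw [hfix c hac hcb] at this
      exact absurd (this.trans (hle.trans hzb)) hac.not_ge
    have hbc : b < c := by
      rcases lt_trichotomy b c with h | rfl | h
      · exact h
      · exact absurd hcb (lt_irrefl _)
      · exact absurd hcb (hc c (PNat.coe_lt_coe a c |>.1 (ha.trans_lt hcl)) h hac)
    refine absurd (y4 b c hbc hb ?_) hle.not_gt
    rwa [hfix c hac hcb, Equiv.swap_apply_right]
  have left : ∀ i, (r i : ℕ) ≤ k → i ≠ b := by rintro i hi rfl; omega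
  have right : ∀ i, k < (r i : ℕ) → i ≠ a := by rintro i hi rfl; omega
  constructor
  · refine (kBruhatCover_iff (hx.mul hρ)).2 ⟨r a, r b, hra, hrb, ?_, ?_, ?_⟩
    · rw [mul_assoc, Equiv.swap_mul_eq_mul_swap, inv_inv, mul_assoc]
    · simpa only [Equiv.Perm.mul_apply, hr] using hab
    · intro c hac hcb
      obtain ⟨c, rfl⟩ := r.surjective c
      simp only [Equiv.Perm.mul_apply, hr]
      intro h5 h6
      rcases le_or_gt (r c : ℕ) k with hk | hk
      · exact (hleft c hk h5 h6).asymm (h3 a c hac hk h5)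
      · exact (hright c hk h5 h6).asymm (h4 c b hcb hk h6)
  · constructor
    · intro i hi
      obtain ⟨i, rfl⟩ := r.surjective i
      simp only [Equiv.Perm.mul_apply, hr]
      rcases eq_or_ne i a with rfl | hia
      · rwa [Equiv.swap_apply_left]
      · rw [Equiv.swap_apply_of_ne_of_ne hia (left i hi)]
        exact h1 i hi
    · intro i hi
      obtain ⟨i, rfl⟩ := r.surjective i
      simp only [Equiv.Perm.mul_apply, hr]
      rcases eq_or_ne i b with rfl | hib
      · rwa [Equiv.swap_apply_right]
      · rw [Equiv.swap_apply_of_ne_of_ne (right i hi) hib]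
        exact h2 i hi
    · intro i j hij hj
      obtain ⟨i, rfl⟩ := r.surjective i
      obtain ⟨j, rfl⟩ := r.surjective j
      have hi : (r i : ℕ) ≤ k := (PNat.coe_le_coe _ _ |>.2 hij.le).trans hj
      simp only [Equiv.Perm.mul_apply, hr]
      rcases eq_or_ne j a with rfl | hja
      · have hij' : i ≠ j := by rintro rfl; exact hij.false
        rw [Equiv.swap_apply_left, Equiv.swap_apply_of_ne_of_ne hij' (left i hi)]
        intro hib
        rcases lt_or_gt_of_ne (hne _ _ hij') with h | h
        · exact h3 i j hij hj h
        · exact hleft i hi h hib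
      rw [Equiv.swap_apply_of_ne_of_ne hja (left j hj)]
      rcases eq_or_ne i a with rfl | hia
      · rw [Equiv.swap_apply_left]
        exact fun h => h3 i j hij hj (hab.trans h)
      · rw [Equiv.swap_apply_of_ne_of_ne hia (left i hi)]
        exact h3 i j hij hj
    · intro i j hij hi
      obtain ⟨i, rfl⟩ := r.surjective i
      obtain ⟨j, rfl⟩ := r.surjective j
      have hj : k < (r j : ℕ) := hi.trans (PNat.coe_lt_coe _ _ |>.2 hij)
      simp only [Equiv.Perm.mul_apply, hr]
      rcases eq_or_ne i b with rfl | hib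
      · have hij' : j ≠ i := by rintro rfl; exact hij.false
        rw [Equiv.swap_apply_right, Equiv.swap_apply_of_ne_of_ne (right j hj) hij']
        intro haj
        rcases lt_or_gt_of_ne (hne _ _ hij') with h | h
        · exact hright j hj haj h
        · exact h4 i j hij hi h
      rw [Equiv.swap_apply_of_ne_of_ne (right i hi) hib]
      rcases eq_or_ne j b with rfl | hjb
      · rw [Equiv.swap_apply_right]
        exact fun h => h4 i j hij hi (h.trans hab)
      · rw [Equiv.swap_apply_of_ne_of_ne (right j hj) hjb]
        exact h4 i j hij hi

theorem kBruhatLE.mul_right {k l : ℕ} {x y z ρ : Equiv.Perm ℕ+} (hx : finSupp x)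
    (hρ : finSupp ρ) (hxy : kBruhatLE l x y) (hyz : kBruhatLE l y z)
    (h : BruhatCriterion k (x * ρ) (z * ρ)) :
    kBruhatLE k (x * ρ) (y * ρ) ∧ BruhatCriterion k (y * ρ) (z * ρ) := by
  induction hxy using Relation.ReflTransGen.head_induction_on with
  | refl => exact ⟨.refl, h⟩
  | @head x x' hxx' hx'y ih =>
    have hx' := finSupp_of_kBruhatCover hxx' hx
    obtain ⟨hcov, hcrit⟩ :=
      cover_mul_right hx hρ hxx' (kBruhatLE.criterion (hx'y.trans hyz) hx') h
    obtain ⟨hle, hcrit'⟩ := ih hx' hcrit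
    exact ⟨.head hcov hle, hcrit'⟩

/-- The relation `≼` can be tested at any base point `u` with `u ≤_k ζ∘u`. -/
theorem preceq.le_and_le {k : ℕ} {η ζ u : Equiv.Perm ℕ+} (h : preceq η ζ) (hu : finSupp u)
    (huζ : kBruhatLE k u (ζ * u)) : kBruhatLE k u (η * u) ∧ kBruhatLE k (η * u) (ζ * u) := by
  obtain ⟨l, -, x, hx, h1, h2⟩ := h
  have hρ := hx.inv.mul hu
  have key : ∀ v : Equiv.Perm ℕ+, v * x * (x⁻¹ * u) = v * u := fun v => by group
  have key₁ : x * (x⁻¹ * u) = u := by group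
  have h3 := h1.mul_right hx hρ h2 (k := k) (by rw [key, key₁]; exact huζ.criterion hu)
  have h4 := h2.mul_right (finSupp_of_kBruhatLE h1 hx) hρ .refl h3.2
  simp only [key, key₁] at h3 h4
  exact ⟨h3.1, h4.1⟩

/-- Theorem 3.2.3(iv): if `η ≼ ζ`, then `ξ ↦ ξ∘η⁻¹` is an order isomorphism
`[η,ζ]_≼ ≅ [e, ζ∘η⁻¹]_≼`. -/
theorem stmt10 (η ζ : Equiv.Perm ℕ+) (hη : finSupp η) (hζ : finSupp ζ)
    (h : preceq η ζ) :
    Set.BijOn (fun ξ => ξ * η⁻¹) {ξ | preceq η ξ ∧ preceq ξ ζ}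
      {χ | preceq χ (ζ * η⁻¹)} ∧
    ∀ ξ ξ' : Equiv.Perm ℕ+,
      (preceq η ξ ∧ preceq ξ ζ) → (preceq η ξ' ∧ preceq ξ' ζ) →
      (preceq ξ ξ' ↔ preceq (ξ * η⁻¹) (ξ' * η⁻¹)) := by
  obtain ⟨k, hk, u, hu, huη, hηζ⟩ := h
  have hηu := hη.mul hu
  have huζ : kBruhatLE k u (ζ * u) := huη.trans hηζ
  have key : ∀ v : Equiv.Perm ℕ+, v * η⁻¹ * (η * u) = v * u := fun v => by group
  have mem : ∀ ξ, preceq η ξ ∧ preceq ξ ζ →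
      kBruhatLE k u (ξ * u) ∧ kBruhatLE k (η * u) (ξ * u) ∧ kBruhatLE k (ξ * u) (ζ * u) := by
    rintro ξ ⟨h1, h2⟩
    obtain ⟨h3, h4⟩ := h2.le_and_le hu huζ
    exact ⟨h3, (h1.le_and_le hu h3).2, h4⟩
  refine ⟨⟨fun ξ hξ => ?_, (mul_left_injective _).injOn, fun χ hχ => ?_⟩, fun ξ ξ' hξ hξ' => ?_⟩
  · obtain ⟨-, h1, h2⟩ := mem ξ hξ
    exact ⟨k, hk, η * u, hηu, by rwa [key], by rwa [key, key]⟩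
  · obtain ⟨h1, h2⟩ := preceq.le_and_le hχ hηu (by rwa [key])
    rw [key] at h2
    rw [← mul_assoc] at h1 h2
    exact ⟨χ * η, ⟨⟨k, hk, u, hu, huη, h1⟩, ⟨k, hk, u, hu, huη.trans h1, h2⟩⟩, by simp⟩
  · obtain ⟨h1, h2, -⟩ := mem ξ hξ
    obtain ⟨h3, h4, -⟩ := mem ξ' hξ'
    constructor
    · intro h
      exact ⟨k, hk, η * u, hηu, by rwa [key], by rw [key, key]; exact (h.le_and_le hu h3).2⟩
    · intro h
      have := (h.le_and_le hηu (by rwa [key])).2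
      rw [key, key] at this
      exact ⟨k, hk, u, hu, h1, this⟩
end
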